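/- arXiv:2102.08281 — 3 statements merged into one kernel-verified Lean document; each statement's English description precedes it below -/
import Mathlib

section
/- Fix an integer n ≥ 0. Let G be the group (under composition) of order-preserving bijections f : ℤ → ℤ satisfying f(x + (n+1)) = f(x) + (n+1) for all x ∈ ℤ, and let N ⊆ G be the subgroup consisting of the translations x ↦ x + (n+1)·k for k ∈ ℤ. Then N is a normal subgroup of G, and the homomorphism ℤ/(n+1)ℤ → G/N sending the class of 1 to the class of the translation x ↦ x + 1 is a group isomorphism. (This identifies the automorphism group of the object [n]_Λ in the cyclic category Λ as the cyclic group of order n+1 generated by the cyclic operator τ_n.) -/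
/-- The group of order-preserving bijections `f : ℤ → ℤ` with
`f (x + (n+1)) = f x + (n+1)`, as a subgroup of the permutation group of `ℤ`. -/
def paracyclicAut (n : ℕ) : Subgroup (Equiv.Perm ℤ) where
  carrier := {f : Equiv.Perm ℤ | Monotone f ∧ ∀ x : ℤ, f (x + (n + 1)) = f x + (n + 1)}
  one_mem' := ⟨monotone_id, fun _ => rfl⟩
  mul_mem' := by
    rintro f g ⟨hf1, hf2⟩ ⟨hg1, hg2⟩
    refine ⟨hf1.comp hg1, fun x => ?_⟩
    show f (g (x + (n + 1))) = f (g x) + (n + 1)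
    rw [hg2, hf2]
  inv_mem' := by
    rintro f ⟨hf1, hf2⟩
    have hs : StrictMono f := hf1.strictMono_of_injective f.injective
    have hi : ∀ y : ℤ, f (f⁻¹ y) = y := fun y => f.apply_symm_apply y
    refine ⟨fun a b hab => ?_, fun x => ?_⟩
    · by_contra h
      push_neg at h
      have h2 := hs h
      simp only [hi] at h2
      exact absurd hab (not_le.mpr h2)
    · apply f.injective
      rw [hi, hf2, hi]

/-- The subgroup of translations `x ↦ x + (n+1)·k`, `k ∈ ℤ`. -/
def paracyclicTranslations (n : ℕ) : Subgroup (Equiv.Perm ℤ) where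
  carrier := {f : Equiv.Perm ℤ | ∃ k : ℤ, f = Equiv.addRight ((n + 1 : ℤ) * k)}
  one_mem' := ⟨0, by ext x; simp⟩
  mul_mem' := by
    rintro f g ⟨k, rfl⟩ ⟨l, rfl⟩
    exact ⟨l + k, by ext x; simp; ring⟩
  inv_mem' := by
    rintro f ⟨k, rfl⟩
    exact ⟨-k, by ext x; simp⟩

/-- The translation `x ↦ x + 1` lies in the group of order-preserving bijections
commuting with translation by `n + 1`. -/
theorem addRight_one_mem_paracyclicAut (n : ℕ) :
    Equiv.addRight (1 : ℤ) ∈ paracyclicAut n :=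
  ⟨fun a b hab => by simpa using hab, fun x => by simp; ring⟩

/-- A monotone permutation of `ℤ` is the translation by its value at `0`. -/
theorem Equiv.Perm.eq_addRight_of_monotone {f : Equiv.Perm ℤ} (hf : Monotone f) :
    f = Equiv.addRight (f 0) := by
  have hs : StrictMono f := hf.strictMono_of_injective f.injective
  have hstep (x : ℤ) : f (x + 1) = f x + 1 := by
    refine le_antisymm (not_lt.mp fun h => ?_) (hs (lt_add_one x))
    obtain ⟨y, hy⟩ := f.surjective (f x + 1)
    have hxy : x < y := hs.lt_iff_lt.mp (by lia)
    have hyx : y < x + 1 := hs.lt_iff_lt.mp (by lia)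
    lia
  ext x
  rw [Equiv.coe_addRight]
  induction x using Int.induction_on with
  | zero => simp
  | succ k ih => rw [hstep, ih]; ring
  | pred k ih =>
    have h := hstep (-k - 1)
    rw [sub_add_cancel] at h
    lia

theorem addRight_mem_paracyclicAut (n : ℕ) (c : ℤ) : Equiv.addRight c ∈ paracyclicAut n :=
  ⟨fun a b hab => by simpa using hab, fun x => by simp; ring⟩

/-- The homomorphism sending the translation by `c` to the residue of `c` modulo `n + 1`. -/
def paracyclicAutToZMod (n : ℕ) : paracyclicAut n →* Multiplicative (ZMod (n + 1)) where
  toFun f := Multiplicative.ofAdd ((f.1 0 : ℤ) : ZMod (n + 1))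
  map_one' := by simp
  map_mul' f g := by
    have h : (f * g).1 0 = f.1 0 + g.1 0 := by
      change f.1 (g.1 0) = _
      rw [Equiv.Perm.eq_addRight_of_monotone f.2.1]
      simp [add_comm]
    rw [h, Int.cast_add, ofAdd_add]

theorem paracyclicAutToZMod_surjective (n : ℕ) :
    Function.Surjective (paracyclicAutToZMod n) := fun a => by
  obtain ⟨c, hc⟩ := ZMod.intCast_surjective a.toAdd
  exact ⟨⟨Equiv.addRight c, addRight_mem_paracyclicAut n c⟩, by
    simp [paracyclicAutToZMod, hc]⟩

theorem ker_paracyclicAutToZMod (n : ℕ) :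
    (paracyclicAutToZMod n).ker = (paracyclicTranslations n).subgroupOf (paracyclicAut n) := by
  ext f
  have hker : f ∈ (paracyclicAutToZMod n).ker ↔ ((n + 1 : ℕ) : ℤ) ∣ f.1 0 := by
    rw [← ZMod.intCast_zmod_eq_zero_iff_dvd]
    exact ofAdd_eq_one
  rw [hker, Subgroup.mem_subgroupOf, Nat.cast_succ]
  constructor
  · rintro ⟨k, hk⟩
    exact ⟨k, by rw [← hk]; exact Equiv.Perm.eq_addRight_of_monotone f.2.1⟩
  · rintro ⟨k, hk⟩
    exact ⟨k, by rw [hk]; simp⟩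

/-- The subgroup `N` of translations by multiples of `n+1` is normal in the group `G` of
order-preserving bijections `f : ℤ → ℤ` with `f (x + (n+1)) = f x + (n+1)`, and the
homomorphism `ℤ/(n+1)ℤ → G/N` sending the class of `1` to the class of the translation
`x ↦ x + 1` is a group isomorphism.  (This identifies `Aut_Λ([n]_Λ)` as the cyclic group
of order `n+1` generated by `τ_n`.) -/
theorem paracyclicAut_quotient_iso_zmod (n : ℕ) :
    paracyclicTranslations n ≤ paracyclicAut n ∧
    ∃ _ : ((paracyclicTranslations n).subgroupOf (paracyclicAut n)).Normal,
    ∃ e : Multiplicative (ZMod (n + 1)) ≃*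
        (paracyclicAut n ⧸ (paracyclicTranslations n).subgroupOf (paracyclicAut n)),
      e (Multiplicative.ofAdd (1 : ZMod (n + 1))) =
        QuotientGroup.mk ⟨Equiv.addRight (1 : ℤ), addRight_one_mem_paracyclicAut n⟩ := by
  have hN : ((paracyclicTranslations n).subgroupOf (paracyclicAut n)).Normal :=
    ker_paracyclicAutToZMod n ▸ MonoidHom.normal_ker _
  refine ⟨?_, hN, ?_⟩
  · rintro _ ⟨k, rfl⟩
    exact addRight_mem_paracyclicAut n _
  · refine ⟨((QuotientGroup.quotientMulEquivOfEq (ker_paracyclicAutToZMod n).symm).trans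
      (QuotientGroup.quotientKerEquivOfSurjective _ (paracyclicAutToZMod_surjective n))).symm, ?_⟩
    rw [MulEquiv.symm_apply_eq, MulEquiv.trans_apply, QuotientGroup.quotientMulEquivOfEq_mk]
    unfold QuotientGroup.quotientKerEquivOfSurjective
    rw [QuotientGroup.quotientKerEquivOfRightInverse_apply]
    rw [QuotientGroup.kerLift_mk]
    simp [paracyclicAutToZMod]
end

section
/- Fix an integer n ≥ 1, and let C be the chain complex of abelian groups defined in the context (the explicit complex computing the Hochschild homology of ℤ[t]/tⁿ). Then H₀(C) ≅ ℤⁿ, and for every integer k ≥ 1 one has H_{2k}(C) ≅ ℤ^{n−1}, while for every integer k ≥ 0 one has H_{2k+1}(C) ≅ ℤ^{n−1} ⊕ ℤ/nℤ. -/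
open CategoryTheory

/-- The differential of the complex computing `HH(ℤ[t]/tⁿ)`: on the degree-`2k`
component `ℤⁿ` (basis `t^a y^{[k]}`, `0 ≤ a ≤ n-1`) it sends `y^{[k]}` to
`n · t^{n-1} y^{[k-1]} dt` and `t^a y^{[k]}` to `0` for `a ≥ 1`. -/
def hhDiff (n : ℕ) (hn : 0 < n) : (Fin n → ℤ) →ₗ[ℤ] (Fin n → ℤ) where
  toFun f := fun j => if (j : ℕ) = n - 1 then (n : ℤ) * f ⟨0, hn⟩ else 0
  map_add' f g := by
    funext j
    by_cases h : (j : ℕ) = n - 1 <;> simp [h] <;> try ring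
  map_smul' c f := by
    funext j
    by_cases h : (j : ℕ) = n - 1 <;> simp [h] <;> try ring

/-- The chain complex `C` of abelian groups with `C_{2k}` free on `t^a y^{[k]}`
(`0 ≤ a ≤ n-1`), `C_{2k+1}` free on `t^a y^{[k]} dt` (`0 ≤ a ≤ n-1`), with
`∂(y^{[k]}) = n t^{n-1} y^{[k-1]} dt`, `∂(t^a y^{[k]}) = 0` for `a ≥ 1`, and zero
differential out of odd degrees: the underlying complex of the differential graded
algebra `(ℤ[t]/tⁿ ⊗ Λ(dt) ⊗ ℤ⟨y⟩, ∂)` computing the Hochschild homology of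
`ℤ[t]/tⁿ`.  Every component is `ℤⁿ`, and the differential `X (j+1) ⟶ X j` is the
map above when `j` is odd and `0` when `j` is even. -/
noncomputable def hhComplex (n : ℕ) (hn : 0 < n) : ChainComplex (ModuleCat ℤ) ℕ :=
  ChainComplex.of (fun _ => ModuleCat.of ℤ (Fin n → ℤ))
    (fun j => if Odd j then ModuleCat.ofHom (hhDiff n hn) else 0)
    (fun j => by
      rcases Nat.even_or_odd j with h | h
      · rw [if_neg (Nat.not_odd_iff_even.mpr h)]
        exact Limits.comp_zero
      · rw [if_neg (by simp [Nat.odd_add_one, h])]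
        exact Limits.zero_comp)

/-- If a linear map `p` restricts to a surjection from the cycles onto `M` whose kernel consists
of the boundaries, then it identifies the homology with `M`. -/
theorem ChainComplex.nonempty_homology_addEquiv {R : Type*} [Ring R]
    (K : ChainComplex (ModuleCat R) ℕ) {j k : ℕ}
    (hk : (ComplexShape.down ℕ).next j = k) {M : Type*} [AddCommGroup M] [Module R M]
    (p : K.X j →ₗ[R] M) (hsurj : ∀ m, ∃ x, (K.d j k).hom x = 0 ∧ p x = m)
    (hker : ∀ x, (K.d j k).hom x = 0 → (p x = 0 ↔ ∃ y, (K.d (j + 1) j).hom y = x)) :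
    Nonempty (K.homology j ≃+ M) := by
  let S := K.sc' (j + 1) j k
  let e : K.homology j ≅ S.moduleCatLeftHomologyData.H :=
    ShortComplex.homologyMapIso (K.isoSc' (j + 1) j k (by simp) hk) ≪≫ S.moduleCatHomologyIso
  let q : LinearMap.ker S.g.hom →ₗ[R] M := p.comp (LinearMap.ker S.g.hom).subtype
  have hq : Function.Surjective q := fun m ↦ by
    obtain ⟨x, hx, hm⟩ := hsurj m
    exact ⟨⟨x, hx⟩, hm⟩
  have hr : LinearMap.range S.moduleCatToCycles = LinearMap.ker q := by
    ext ⟨x, hx⟩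
    refine Iff.trans ?_ (hker x hx).symm
    exact exists_congr fun y ↦ Subtype.ext_iff
  exact ⟨(e.toLinearEquiv.trans ((Submodule.quotEquivOfEq _ _ hr).trans
    (q.quotKerEquivOfSurjective hq))).toAddEquiv⟩

theorem hhComplex_d (n : ℕ) (hn : 0 < n) (j : ℕ) :
    (hhComplex n hn).d (j + 1) j =
      if Odd j then ModuleCat.ofHom (hhDiff n hn) else
        (0 : ModuleCat.of ℤ (Fin n → ℤ) ⟶ ModuleCat.of ℤ (Fin n → ℤ)) :=
  ChainComplex.of_d (fun _ ↦ ModuleCat.of ℤ (Fin n → ℤ))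
    (fun j ↦ if Odd j then ModuleCat.ofHom (hhDiff n hn) else 0) j

theorem hhComplex_d_even (n : ℕ) (hn : 0 < n) (k : ℕ) :
    (hhComplex n hn).d (2 * k + 1) (2 * k) = 0 :=
  (hhComplex_d n hn _).trans (if_neg (by simp))

theorem hhComplex_d_odd (n : ℕ) (hn : 0 < n) (k : ℕ) :
    (hhComplex n hn).d (2 * k + 1 + 1) (2 * k + 1) = ModuleCat.ofHom (hhDiff n hn) :=
  (hhComplex_d n hn _).trans (if_pos (odd_two_mul_add_one k))

theorem hhDiff_eq_zero_iff (m : ℕ) (f : Fin (m + 1) → ℤ) :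
    hhDiff (m + 1) m.succ_pos f = 0 ↔ f 0 = 0 := by
  refine ⟨fun h ↦ ?_, fun h ↦ ?_⟩
  · have := congrFun h (Fin.last m)
    simp [hhDiff] at this
    exact this.resolve_left (by omega)
  · funext j
    simp [hhDiff, h]

theorem exists_hhDiff_eq_iff (m : ℕ) (g : Fin (m + 1) → ℤ) :
    (∃ f, hhDiff (m + 1) m.succ_pos f = g) ↔
      Fin.init g = 0 ∧ ((g (Fin.last m) : ℤ) : ZMod (m + 1)) = 0 := by
  have hdvd : ((g (Fin.last m) : ℤ) : ZMod (m + 1)) = 0 ↔ ((m + 1 : ℕ) : ℤ) ∣ g (Fin.last m) :=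
    ZMod.intCast_zmod_eq_zero_iff_dvd _ _
  rw [hdvd]
  constructor
  · rintro ⟨f, rfl⟩
    refine ⟨?_, f 0, by simp [hhDiff]⟩
    funext i
    simp [hhDiff, Fin.init, i.isLt.ne]
  · rintro ⟨hi, c, hc⟩
    refine ⟨fun _ ↦ c, funext fun j ↦ ?_⟩
    refine Fin.lastCases ?_ (fun i ↦ ?_) j
    · simp [hhDiff, hc]
    · have := congrFun hi i
      simp only [Fin.init, Pi.zero_apply] at this
      simp [hhDiff, this, i.isLt.ne]

/-- The map sending a chain to its coefficients at `t^a` for `a < m`, together with the class of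
its coefficient at `t^m` modulo `m + 1`. -/
def initProdCastLast (m : ℕ) : (Fin (m + 1) → ℤ) →ₗ[ℤ] (Fin m → ℤ) × ZMod (m + 1) :=
  (LinearMap.funLeft ℤ ℤ Fin.castSucc).prod
    ((Int.castAddHom (ZMod (m + 1))).toIntLinearMap.comp (LinearMap.proj (Fin.last m)))

/-- The homology of the explicit complex computing the Hochschild homology of
`ℤ[t]/tⁿ` (`n ≥ 1`): `H₀ ≅ ℤⁿ`, `H_{2k} ≅ ℤ^{n-1}` for `k ≥ 1`, and
`H_{2k+1} ≅ ℤ^{n-1} ⊕ ℤ/nℤ` for `k ≥ 0`. -/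
theorem hhComplex_homology (n : ℕ) (hn : 0 < n) :
    Nonempty (((hhComplex n hn).homology 0) ≃+ (Fin n → ℤ)) ∧
    (∀ k : ℕ, 1 ≤ k →
      Nonempty (((hhComplex n hn).homology (2 * k)) ≃+ (Fin (n - 1) → ℤ))) ∧
    (∀ k : ℕ,
      Nonempty (((hhComplex n hn).homology (2 * k + 1)) ≃+
        ((Fin (n - 1) → ℤ) × ZMod n))) := by
  obtain ⟨m, rfl⟩ : ∃ m, n = m + 1 := ⟨n - 1, by omega⟩
  refine ⟨?_, fun k hk ↦ ?_, fun k ↦ ?_⟩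
  · have hd : (hhComplex (m + 1) hn).d 0 0 = 0 := HomologicalComplex.shape _ _ _ (by simp)
    have hd' := hhComplex_d_even (m + 1) hn 0
    refine (hhComplex (m + 1) hn).nonempty_homology_addEquiv ChainComplex.next_nat_zero
      (M := Fin (m + 1) → ℤ) LinearMap.id (fun x ↦ ⟨x, by rw [hd]; rfl, rfl⟩) fun x _ ↦ ?_
    rw [show (hhComplex (m + 1) hn).d (0 + 1) 0 = 0 from hd']
    exact ⟨fun h ↦ ⟨0, h.symm⟩, fun ⟨_, h⟩ ↦ h.symm⟩
  · obtain ⟨k, rfl⟩ : ∃ l, k = l + 1 := ⟨k - 1, by omega⟩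
    have hd := hhComplex_d_odd (m + 1) hn k
    refine (hhComplex (m + 1) hn).nonempty_homology_addEquiv
      (ChainComplex.next_nat_succ (2 * k + 1)) (M := Fin m → ℤ)
      (LinearMap.funLeft ℤ ℤ Fin.succ) (fun x ↦ ⟨(Fin.cons 0 x : Fin (m + 1) → ℤ), ?_, ?_⟩)
      fun x hx ↦ ?_
    · rw [hd]
      exact (hhDiff_eq_zero_iff m _).2 rfl
    · rfl
    · rw [hd] at hx
      have h0 := (hhDiff_eq_zero_iff m x).1 hx
      rw [show (hhComplex (m + 1) hn).d (2 * k + 1 + 1 + 1) (2 * k + 1 + 1) = 0 from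
        hhComplex_d_even (m + 1) hn (k + 1)]
      refine ⟨fun h ↦ ⟨0, ?_⟩, ?_⟩
      · exact (funext fun j ↦ Fin.cases h0 (fun i ↦ congrFun h i) j :
          (x : Fin (m + 1) → ℤ) = 0).symm
      · rintro ⟨_, rfl⟩
        rfl
  · have hd := hhComplex_d_even (m + 1) hn k
    refine (hhComplex (m + 1) hn).nonempty_homology_addEquiv
      (ChainComplex.next_nat_succ (2 * k)) (initProdCastLast m)
      (fun ⟨x, z⟩ ↦ ?_) fun x _ ↦ ?_
    · obtain ⟨c, rfl⟩ := ZMod.intCast_surjective z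
      refine ⟨(Fin.snoc x c : Fin (m + 1) → ℤ), by rw [hd]; rfl, Prod.ext ?_ ?_⟩
      · exact Fin.init_snoc (α := fun _ ↦ ℤ) c x
      · exact congrArg Int.cast (Fin.snoc_last (α := fun _ ↦ ℤ) c x)
    · rw [hhComplex_d_odd]
      exact Prod.ext_iff.trans (exists_hhDiff_eq_iff m x).symm
end

section
/- Fix an integer n ≥ 1, and let C be the chain complex of abelian groups defined in the context. Assign to each generator the weight w(t^a y^{[k]}) = a + kn and w(t^a y^{[k]} dt) = a + kn + 1; the differential preserves weight, so C decomposes as a direct sum of subcomplexes C(i) for i ≥ 0. Then for every integer i ≥ 1: if n divides i, say i = kn with k ≥ 1, then H_{2k−1}(C(i)) ≅ ℤ/nℤ and H_j(C(i)) = 0 for all j ≠ 2k−1; if n does not divide i, write i = ℓn + r with 1 ≤ r ≤ n−1, then H_{2ℓ}(C(i)) ≅ ℤ, H_{2ℓ+1}(C(i)) ≅ ℤ, and H_j(C(i)) = 0 for all other j. In particular, for every i ≥ 1 the complex C(i) has homology concentrated in degrees ≥ 2⌊(i−1)/n⌋ (the weight-graded connectivity bound underlying the paper's connectivity estimate for THH(S[t]/tⁿ)_i).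 -/
open CategoryTheory

/-- The set of weight-`i` basis elements of the complex computing `HH(ℤ[t]/tⁿ)` in
homological degree `j`: for `j = 2k` these are the `t^a y^{[k]}` with
`a + kn = i`, and for `j = 2k+1` these are the `t^a y^{[k]} dt` with
`a + kn + 1 = i` (always `0 ≤ a ≤ n-1`). -/
def wBasis (n i j : ℕ) : Type := {a : Fin n // (a : ℕ) + (j / 2) * n + j % 2 = i}

instance (n i j : ℕ) : Fintype (wBasis n i j) := Subtype.fintype _
instance (n i j : ℕ) : DecidableEq (wBasis n i j) := Subtype.instDecidableEq

/-- The matrix of the weight-`i` differential `C(i)_{j+1} → C(i)_j`: it is nonzero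
only from even degrees `j + 1 = 2k` to odd degrees `j = 2k-1`, where it sends the
basis element `y^{[k]}` (i.e. `a = 0`) to `n · t^{n-1} y^{[k-1]} dt` and kills
`t^a y^{[k]}` for `a ≥ 1`. -/
def wDiffMat (n i j : ℕ) : Matrix (wBasis n i j) (wBasis n i (j + 1)) ℤ :=
  fun b a => if j % 2 = 1 ∧ ((a.1 : ℕ) = 0 ∧ (b.1 : ℕ) = n - 1) then (n : ℤ) else 0

/-- The weight-`i` subcomplex `C(i)` of the complex `C` computing the Hochschild
homology of `ℤ[t]/tⁿ`, where generators carry the weights `w(t^a y^{[k]}) = a + kn`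
and `w(t^a y^{[k]} dt) = a + kn + 1`; the differential preserves weight and `C` is
the direct sum of the `C(i)`. -/
noncomputable def wComplex (n i : ℕ) : ChainComplex (ModuleCat ℤ) ℕ :=
  ChainComplex.of (fun j => ModuleCat.of ℤ (wBasis n i j → ℤ))
    (fun j => ModuleCat.ofHom (wDiffMat n i j).mulVecLin)
    (fun j => by
      have hz : wDiffMat n i j * wDiffMat n i (j + 1) = 0 := by
        ext b a
        simp only [Matrix.mul_apply, wDiffMat, Matrix.zero_apply]
        apply Finset.sum_eq_zero
        intro c _
        rcases Nat.even_or_odd j with h | h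
        · have h0 : j % 2 = 0 := Nat.even_iff.mp h
          simp [h0]
        · have h1 : j % 2 = 1 := Nat.odd_iff.mp h
          have h2 : (j + 1) % 2 = 0 := by omega
          simp [h2]
      show ModuleCat.ofHom ((wDiffMat n i j).mulVecLin ∘ₗ (wDiffMat n i (j + 1)).mulVecLin) = 0
      rw [← Matrix.mulVecLin_mul, hz, Matrix.mulVecLin_zero]
      rfl)

/-- If the outgoing differential in degree `j` vanishes, homology is computed by any
surjection out of `K.X j` whose kernel is the image of the incoming differential. -/
lemma ChainComplex.nonempty_homology_addEquiv_s10 (K : ChainComplex (ModuleCat.{0} ℤ) ℕ) (j : ℕ)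
    (hd : ∀ k, j = k + 1 → K.d j k = 0) {A : Type} [AddCommGroup A] (φ : K.X j →ₗ[ℤ] A)
    (hφ : Function.Surjective φ) (hexact : Function.Exact (K.d (j + 1) j).hom φ) :
    Nonempty (K.homology j ≃+ A) := by
  let S := K.sc' (j + 1) j ((ComplexShape.down ℕ).next j)
  have hg : S.g = 0 := by
    by_cases h : (ComplexShape.down ℕ).Rel j ((ComplexShape.down ℕ).next j)
    · exact hd _ h.symm
    · exact K.shape _ _ h
  let e : K.homology j ≅ ModuleCat.of ℤ A :=
    ShortComplex.homologyMapIso (K.isoSc' (j + 1) j _ (ChainComplex.prev ℕ j) rfl) ≪≫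
      (ShortComplex.LeftHomologyData.ofIsColimitCokernelCofork S hg _
        (ModuleCat.isColimitCokernelCofork (K.d (j + 1) j) (ModuleCat.ofHom φ)
          hexact hφ)).homologyIso
  exact ⟨e.toLinearEquiv.toAddEquiv⟩

/-- The homology vanishes in every degree where the outgoing differential is injective. -/
lemma ChainComplex.subsingleton_homology_of_injective (K : ChainComplex (ModuleCat ℤ) ℕ)
    (j k : ℕ) (hjk : (ComplexShape.down ℕ).next j = k)
    (hd : Function.Injective (K.d j k).hom) : Subsingleton (K.homology j) := by
  refine ModuleCat.subsingleton_of_isZero ?_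
  rw [← HomologicalComplex.exactAt_iff_isZero_homology,
    K.exactAt_iff' (j + 1) j k (ChainComplex.prev ℕ j) hjk, ShortComplex.moduleCat_exact_iff]
  exact fun x hx => ⟨0, (map_zero _).trans (hd (hx.trans (map_zero _).symm)).symm⟩

lemma wBasis_spec {n i j : ℕ} (b : wBasis n i j) :
    j % 2 ≤ i ∧ (i - j % 2) / n = j / 2 ∧ (b.1 : ℕ) = (i - j % 2) % n := by
  obtain ⟨a, rfl⟩ := b
  refine ⟨Nat.le_add_left _ _, ?_, ?_⟩
  · rw [Nat.add_sub_cancel, Nat.add_mul_div_right _ _ a.pos, Nat.div_eq_of_lt a.2, zero_add]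
  · rw [Nat.add_sub_cancel, Nat.add_mul_mod_self_right, Nat.mod_eq_of_lt a.2]

instance (n i j : ℕ) : Subsingleton (wBasis n i j) :=
  ⟨fun a b => Subtype.ext (Fin.ext ((wBasis_spec a).2.2.trans (wBasis_spec b).2.2.symm))⟩

lemma nonempty_wBasis {n i j : ℕ} (hn : 0 < n) (hj : j % 2 ≤ i)
    (hdiv : (i - j % 2) / n = j / 2) : Nonempty (wBasis n i j) := by
  refine ⟨⟨⟨(i - j % 2) % n, Nat.mod_lt _ hn⟩, ?_⟩⟩
  have := Nat.mod_add_div' (i - j % 2) n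
  rw [hdiv] at this
  dsimp only
  omega

lemma isEmpty_wBasis {n i j : ℕ} (h : (i - j % 2) / n ≠ j / 2) : IsEmpty (wBasis n i j) :=
  ⟨fun b => h (wBasis_spec b).2.1⟩

lemma wComplex_d (n i j : ℕ) :
    (wComplex n i).d (j + 1) j = ModuleCat.ofHom (wDiffMat n i j).mulVecLin :=
  ChainComplex.of_d (fun j => ModuleCat.of ℤ (wBasis n i j → ℤ))
    (fun j => ModuleCat.ofHom (wDiffMat n i j).mulVecLin) j

lemma wDiffMat_mulVec {n i j : ℕ} (b : wBasis n i j) (a : wBasis n i (j + 1))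
    (x : wBasis n i (j + 1) → ℤ) :
    (wDiffMat n i j).mulVec x b = wDiffMat n i j b a * x a :=
  Fintype.sum_subsingleton _ a

lemma wDiffMat_eq_zero_of_even {n i j : ℕ} (hj : j % 2 = 0) : wDiffMat n i j = 0 := by
  ext b a
  simp [wDiffMat, hj]

lemma wComplex_d_eq_zero {n i j : ℕ} (h : wDiffMat n i j = 0) :
    (wComplex n i).d (j + 1) j = 0 := by
  rw [wComplex_d, h, Matrix.mulVecLin_zero]
  rfl

lemma subsingleton_wComplex_homology {n i j : ℕ} (h : (i - j % 2) / n ≠ j / 2) :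
    Subsingleton ((wComplex n i).homology j) := by
  have := isEmpty_wBasis h
  have : Subsingleton ((wComplex n i).X j) :=
    inferInstanceAs (Subsingleton (wBasis n i j → ℤ))
  exact ChainComplex.subsingleton_homology_of_injective _ _ _ rfl
    (Function.injective_of_subsingleton _)

/-- A degree with a basis element and zero differentials on both sides contributes `ℤ`. -/
lemma nonempty_wComplex_homology_addEquiv_int {n i j : ℕ} (b : wBasis n i j)
    (hout : ∀ k, j = k + 1 → wDiffMat n i k = 0) (hin : wDiffMat n i j = 0) :
    Nonempty ((wComplex n i).homology j ≃+ ℤ) := by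
  refine ChainComplex.nonempty_homology_addEquiv_s10 _ j ?_
    (LinearMap.proj b : (wBasis n i j → ℤ) →ₗ[ℤ] ℤ) (fun z => ⟨fun _ => z, rfl⟩) ?_
  · rintro k rfl
    exact wComplex_d_eq_zero (hout k rfl)
  · rw [wComplex_d_eq_zero hin]
    intro (x : wBasis n i j → ℤ)
    constructor
    · intro (hx : x b = 0)
      exact ⟨0, funext fun c => by rw [Subsingleton.elim c b, hx]; rfl⟩
    · rintro ⟨y, rfl⟩
      rfl

/-- A nonzero differential multiplies the generator by `n`. -/
lemma wDiffMat_apply_of_eq_mul {n m : ℕ} (hn : 0 < n)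
    (b : wBasis n ((m + 1) * n) (2 * m + 1)) (a : wBasis n ((m + 1) * n) (2 * m + 1 + 1)) :
    wDiffMat n ((m + 1) * n) (2 * m + 1) b a = n := by
  have ha : (a.1 : ℕ) = 0 := (wBasis_spec a).2.2.trans (by
    rw [show (2 * m + 1 + 1) % 2 = 0 by omega, Nat.sub_zero, Nat.mul_mod_left])
  have hb := b.2
  simp only [show (2 * m + 1) / 2 = m by omega, show (2 * m + 1) % 2 = 1 by omega, add_mul] at hb
  exact if_pos ⟨by omega, ha, by omega⟩

lemma mul_pred_div {n m : ℕ} (hn : 0 < n) : ((m + 1) * n - 1) / n = m := by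
  rw [add_mul, one_mul, Nat.add_sub_assoc hn, mul_comm, Nat.mul_add_div hn,
    Nat.div_eq_of_lt (by omega)]
  rfl

lemma nonempty_wBasis_of_eq_mul {n m : ℕ} (hn : 0 < n) :
    Nonempty (wBasis n ((m + 1) * n) (2 * m + 1)) := by
  refine nonempty_wBasis hn ?_ ?_
  · have : 0 < (m + 1) * n := Nat.mul_pos m.succ_pos hn
    omega
  · rw [show (2 * m + 1) % 2 = 1 by omega, mul_pred_div hn]
    omega

lemma nonempty_wComplex_homology_addEquiv_zmod {n m : ℕ} (hn : 0 < n) :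
    Nonempty ((wComplex n ((m + 1) * n)).homology (2 * m + 1) ≃+ ZMod n) := by
  obtain ⟨b⟩ := nonempty_wBasis_of_eq_mul (m := m) hn
  obtain ⟨a⟩ : Nonempty (wBasis n ((m + 1) * n) (2 * m + 1 + 1)) := by
    refine nonempty_wBasis hn (by omega) ?_
    rw [show (2 * m + 1 + 1) % 2 = 0 by omega, Nat.sub_zero, Nat.mul_div_cancel _ hn]
    omega
  refine ChainComplex.nonempty_homology_addEquiv_s10 _ _ ?_
    ((Int.castAddHom (ZMod n)).toIntLinearMap ∘ₗ
      (LinearMap.proj b : (wBasis n ((m + 1) * n) (2 * m + 1) → ℤ) →ₗ[ℤ] ℤ)) ?_ ?_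
  · intro k hk
    obtain rfl : k = 2 * m := by omega
    exact wComplex_d_eq_zero (wDiffMat_eq_zero_of_even (by omega))
  · intro z
    obtain ⟨t, rfl⟩ := ZMod.intCast_surjective z
    exact ⟨fun _ => t, rfl⟩
  · rw [wComplex_d]
    intro (x : wBasis n ((m + 1) * n) (2 * m + 1) → ℤ)
    change ((x b : ℤ) : ZMod n) = 0 ↔ ∃ y, (wDiffMat n _ _).mulVec y = x
    rw [ZMod.intCast_zmod_eq_zero_iff_dvd]
    constructor
    · rintro ⟨t, ht⟩
      refine ⟨fun _ => t, funext fun c => ?_⟩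
      rw [wDiffMat_mulVec c a, wDiffMat_apply_of_eq_mul hn, Subsingleton.elim c b, ht]
    · rintro ⟨y, rfl⟩
      rw [wDiffMat_mulVec b a, wDiffMat_apply_of_eq_mul hn]
      exact dvd_mul_right _ _

lemma subsingleton_wComplex_homology_of_eq_mul {n m : ℕ} (hn : 0 < n) :
    Subsingleton ((wComplex n ((m + 1) * n)).homology (2 * m + 1 + 1)) := by
  obtain ⟨b⟩ := nonempty_wBasis_of_eq_mul (m := m) hn
  refine ChainComplex.subsingleton_homology_of_injective _ _ _
    (ChainComplex.next_nat_succ (2 * m + 1)) ?_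
  rw [wComplex_d]
  intro (x : wBasis n ((m + 1) * n) (2 * m + 1 + 1) → ℤ)
    (y : wBasis n ((m + 1) * n) (2 * m + 1 + 1) → ℤ) hxy
  refine funext fun a => ?_
  have h : (wDiffMat n ((m + 1) * n) (2 * m + 1)).mulVec x b =
      (wDiffMat n ((m + 1) * n) (2 * m + 1)).mulVec y b := congrFun hxy b
  rw [wDiffMat_mulVec b a, wDiffMat_mulVec b a, wDiffMat_apply_of_eq_mul hn] at h
  exact mul_left_cancel₀ (by exact_mod_cast hn.ne') h

/-- Homology of the weight-`i` subcomplex `C(i)` (`n ≥ 1`, `i ≥ 1`): if `n ∣ i`, say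
`i = kn` with `k ≥ 1`, then `H_{2k-1}(C(i)) ≅ ℤ/nℤ` and `H_j(C(i)) = 0` for all
`j ≠ 2k-1`; if `n ∤ i`, writing `i = ℓn + r` with `1 ≤ r ≤ n-1`, then
`H_{2ℓ}(C(i)) ≅ ℤ`, `H_{2ℓ+1}(C(i)) ≅ ℤ`, and `H_j(C(i)) = 0` otherwise.  In
particular the homology of `C(i)` is concentrated in degrees `≥ 2⌊(i-1)/n⌋`. -/
theorem wComplex_homology (n : ℕ) (hn : 0 < n) (i : ℕ) (hi : 1 ≤ i) :
    (∀ k : ℕ, 1 ≤ k → i = k * n →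
      Nonempty (((wComplex n i).homology (2 * k - 1)) ≃+ ZMod n) ∧
      ∀ j : ℕ, j ≠ 2 * k - 1 → Subsingleton ((wComplex n i).homology j)) ∧
    (∀ l r : ℕ, 1 ≤ r → r ≤ n - 1 → i = l * n + r →
      Nonempty (((wComplex n i).homology (2 * l)) ≃+ ℤ) ∧
      Nonempty (((wComplex n i).homology (2 * l + 1)) ≃+ ℤ) ∧
      ∀ j : ℕ, j ≠ 2 * l → j ≠ 2 * l + 1 → Subsingleton ((wComplex n i).homology j)) ∧
    (∀ j : ℕ, j < 2 * ((i - 1) / n) → Subsingleton ((wComplex n i).homology j)) := by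
  refine ⟨?_, ?_, ?_⟩
  · rintro k hk rfl
    obtain ⟨m, rfl⟩ := Nat.exists_eq_add_of_le' hk
    refine ⟨nonempty_wComplex_homology_addEquiv_zmod hn, fun j hj => ?_⟩
    by_cases hj' : j = 2 * m + 1 + 1
    · subst hj'
      exact subsingleton_wComplex_homology_of_eq_mul hn
    · apply subsingleton_wComplex_homology
      rcases Nat.mod_two_eq_zero_or_one j with h | h
      · rw [h, Nat.sub_zero, Nat.mul_div_cancel _ hn]
        omega
      · rw [h, mul_pred_div hn]
        omega
  · rintro l r hr hrn rfl
    have hdiv (j : ℕ) : (l * n + r - j % 2) / n = l := by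
      rw [Nat.add_sub_assoc (by omega), mul_comm, Nat.mul_add_div hn,
        Nat.div_eq_of_lt (by omega), add_zero]
    have hempty {j : ℕ} (hj : j ≠ 2 * l) (hj' : j ≠ 2 * l + 1) :
        (l * n + r - j % 2) / n ≠ j / 2 := by
      rw [hdiv]
      omega
    obtain ⟨b⟩ : Nonempty (wBasis n (l * n + r) (2 * l)) :=
      nonempty_wBasis hn (by omega) (by rw [hdiv]; omega)
    obtain ⟨c⟩ : Nonempty (wBasis n (l * n + r) (2 * l + 1)) :=
      nonempty_wBasis hn (by omega) (by rw [hdiv]; omega)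
    refine ⟨nonempty_wComplex_homology_addEquiv_int b ?_ (wDiffMat_eq_zero_of_even (by omega)),
      nonempty_wComplex_homology_addEquiv_int c ?_ ?_,
      fun j hj hj' => subsingleton_wComplex_homology (hempty hj hj')⟩
    · intro k hk
      have := isEmpty_wBasis (hempty (j := k) (by omega) (by omega))
      exact Subsingleton.elim _ _
    · intro k hk
      exact wDiffMat_eq_zero_of_even (by omega)
    · have := isEmpty_wBasis (hempty (j := 2 * l + 1 + 1) (by omega) (by omega))
      exact Subsingleton.elim _ _
  · intro j hj
    apply subsingleton_wComplex_homology
    have : (i - 1) / n ≤ (i - j % 2) / n := Nat.div_le_div_right (by omega)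
    omega
end
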